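/- arXiv:1810.04552 — 2 statements merged into one kernel-verified Lean document; each statement's English description precedes it below -/
import Mathlib

section
/- Let P be a finite poset and K a field. Let (ψ, φ, γ) be a P-graded reduction from a P-graded chain complex (C, π) to a P-graded chain complex (M, π), i.e., a reduction in which ψ, φ and all γ_n are P-filtered. Then (M, π) is strict (π^p ∘ ∂^M_n ∘ π^p = 0 for all n ∈ ℤ and p ∈ P) if and only if γ is a perfect P-filtered splitting homotopy, i.e., (π^p ∘ ∂_n ∘ π^p) ∘ (π^p ∘ γ_{n-1} ∘ π^p) ∘ (π^p ∘ ∂_n ∘ π^p) = π^p ∘ ∂_n ∘ π^p for all n ∈ ℤ and p ∈ P. -/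
/-- A family of projections giving a `P`-grading of a vector space `V`. -/
def IsGrading {K : Type*} [Field K] {P : Type*} [Fintype P]
    {V : Type*} [AddCommGroup V] [Module K V] (π : P → V →ₗ[K] V) : Prop :=
  (∀ p, π p ∘ₗ π p = π p) ∧ (∑ p, π p) = LinearMap.id ∧
    (∀ p q, p ≠ q → π p ∘ₗ π q = 0)

/-- A linear map between `P`-graded vector spaces is `P`-filtered if its
`(p,q)`-component is nonzero only when `p ≤ q`. -/
def IsFilteredMap {K : Type*} [Field K] {P : Type*} [PartialOrder P]
    {V W : Type*} [AddCommGroup V] [Module K V] [AddCommGroup W] [Module K W]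
    (πV : P → V →ₗ[K] V) (πW : P → W →ₗ[K] W) (φ : V →ₗ[K] W) : Prop :=
  ∀ p q : P, πW p ∘ₗ φ ∘ₗ πV q ≠ 0 → p ≤ q

section GradedMaps

variable {K : Type*} [Field K] {P : Type*} [Fintype P]
  {U V W : Type*} [AddCommGroup U] [Module K U] [AddCommGroup V] [Module K V]
  [AddCommGroup W] [Module K W]
  {πU : P → U →ₗ[K] U} {πV : P → V →ₗ[K] V} {πW : P → W →ₗ[K] W}
  {f : U →ₗ[K] V} {g : V →ₗ[K] W}

/-- The components of a composite are given by matrix multiplication of components. -/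
theorem IsGrading.component_comp (hV : IsGrading πV) (f : U →ₗ[K] V) (g : V →ₗ[K] W) (p q : P) :
    πW p ∘ₗ (g ∘ₗ f) ∘ₗ πU q =
      ∑ r, (πW p ∘ₗ g ∘ₗ πV r) ∘ₗ (πV r ∘ₗ f ∘ₗ πU q) := by
  ext x
  have hidem (r : P) (y : V) : πV r (πV r y) = πV r y := LinearMap.congr_fun (hV.1 r) y
  have hsum := LinearMap.congr_fun hV.2.1 (f (πU q x))
  simp only [LinearMap.sum_apply, LinearMap.id_apply] at hsum
  simp only [LinearMap.sum_apply, LinearMap.comp_apply, hidem, ← map_sum, hsum]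

variable [PartialOrder P]

theorem IsFilteredMap.comp (hV : IsGrading πV) (hg : IsFilteredMap πV πW g)
    (hf : IsFilteredMap πU πV f) : IsFilteredMap πU πW (g ∘ₗ f) := by
  intro p q hpq
  rw [hV.component_comp] at hpq
  obtain ⟨r, -, hr⟩ := Finset.exists_ne_zero_of_sum_ne_zero hpq
  refine (hg p r fun h => hr ?_).trans (hf r q fun h => hr ?_)
  · rw [h, LinearMap.zero_comp]
  · rw [h, LinearMap.comp_zero]

/-- Taking diagonal components of filtered maps is compatible with composition. -/
theorem IsFilteredMap.diag_comp (hV : IsGrading πV) (hg : IsFilteredMap πV πW g)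
    (hf : IsFilteredMap πU πV f) (p : P) :
    πW p ∘ₗ (g ∘ₗ f) ∘ₗ πU p = (πW p ∘ₗ g ∘ₗ πV p) ∘ₗ (πV p ∘ₗ f ∘ₗ πU p) := by
  rw [hV.component_comp]
  refine Fintype.sum_eq_single p fun r hr => ?_
  by_cases hpr : p ≤ r
  · have hrp : ¬ r ≤ p := fun h => hr (le_antisymm h hpr)
    rw [not_not.mp (mt (hf r p) hrp), LinearMap.comp_zero]
  · rw [not_not.mp (mt (hg p r) hpr), LinearMap.zero_comp]

end GradedMaps

/-- For a P-graded reduction (ψ, φ, γ) from (C, π) to (M, π),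
the complex (M, π) is strict iff γ is a perfect P-filtered splitting homotopy,
i.e. the diagonal components satisfy ∂^{pp} ∘ γ^{pp} ∘ ∂^{pp} = ∂^{pp}. -/
theorem stmt_11 {K : Type*} [Field K] {P : Type*} [PartialOrder P] [Fintype P]
    {C M : ℤ → Type*}
    [∀ n, AddCommGroup (C n)] [∀ n, Module K (C n)]
    [∀ n, AddCommGroup (M n)] [∀ n, Module K (M n)]
    (πC : ∀ n : ℤ, P → C n →ₗ[K] C n) (πM : ∀ n : ℤ, P → M n →ₗ[K] M n)
    (hgrC : ∀ n, IsGrading (πC n)) (hgrM : ∀ n, IsGrading (πM n))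
    (dC : ∀ n : ℤ, C (n + 1) →ₗ[K] C n) (dM : ∀ n : ℤ, M (n + 1) →ₗ[K] M n)
    (hdfC : ∀ n, IsFilteredMap (πC (n + 1)) (πC n) (dC n))
    (hdfM : ∀ n, IsFilteredMap (πM (n + 1)) (πM n) (dM n))
    (hddC : ∀ (n : ℤ) (x : C (n + 1 + 1)), dC n (dC (n + 1) x) = 0)
    (hddM : ∀ (n : ℤ) (x : M (n + 1 + 1)), dM n (dM (n + 1) x) = 0)
    -- the reduction maps, all P-filtered
    (ψ : ∀ n, C n →ₗ[K] M n) (φ : ∀ n, M n →ₗ[K] C n)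
    (γ : ∀ n : ℤ, C n →ₗ[K] C (n + 1))
    (hψf : ∀ n, IsFilteredMap (πC n) (πM n) (ψ n))
    (hφf : ∀ n, IsFilteredMap (πM n) (πC n) (φ n))
    (hγf : ∀ n, IsFilteredMap (πC n) (πC (n + 1)) (γ n))
    -- the reduction identities
    (hψ : ∀ (n : ℤ) (x : C (n + 1)), ψ n (dC n x) = dM n (ψ (n + 1) x))
    (hφ : ∀ (n : ℤ) (x : M (n + 1)), φ n (dM n x) = dC n (φ (n + 1) x))
    (hψφ : ∀ (n : ℤ) (x : M n), ψ n (φ n x) = x)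
    (hφψ : ∀ (n : ℤ) (x : C (n + 1)),
      φ (n + 1) (ψ (n + 1) x) = x - (γ n (dC n x) + dC (n + 1) (γ (n + 1) x)))
    (hγγ : ∀ (n : ℤ) (x : C n), γ (n + 1) (γ n x) = 0)
    (hγφ : ∀ (n : ℤ) (x : M n), γ n (φ n x) = 0)
    (hψγ : ∀ (n : ℤ) (x : C n), ψ (n + 1) (γ n x) = 0) :
    (∀ (n : ℤ) (p : P), πM n p ∘ₗ dM n ∘ₗ πM (n + 1) p = 0) ↔
      (∀ (n : ℤ) (p : P),
        (πC n p ∘ₗ dC n ∘ₗ πC (n + 1) p) ∘ₗ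
            (πC (n + 1) p ∘ₗ γ n ∘ₗ πC n p) ∘ₗ
            (πC n p ∘ₗ dC n ∘ₗ πC (n + 1) p) =
          πC n p ∘ₗ dC n ∘ₗ πC (n + 1) p) := by
  have hperturb (n : ℤ) : φ n ∘ₗ dM n ∘ₗ ψ (n + 1) = dC n - dC n ∘ₗ γ n ∘ₗ dC n := by
    ext x
    simp [hφ, hφψ, hddC]
  have hfactor (n : ℤ) : dM n = ψ n ∘ₗ (φ n ∘ₗ dM n ∘ₗ ψ (n + 1)) ∘ₗ φ (n + 1) := by
    ext x
    simp [hψφ]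
  have hdψ (n : ℤ) := (hdfM n).comp (hgrM (n + 1)) (hψf (n + 1))
  have hφdψ (n : ℤ) := (hφf n).comp (hgrM n) (hdψ n)
  have hγd (n : ℤ) := (hγf n).comp (hgrC n) (hdfC n)
  have hdiag (n : ℤ) (p : P) : πC n p ∘ₗ (φ n ∘ₗ dM n ∘ₗ ψ (n + 1)) ∘ₗ πC (n + 1) p =
      πC n p ∘ₗ dC n ∘ₗ πC (n + 1) p -
        (πC n p ∘ₗ dC n ∘ₗ πC (n + 1) p) ∘ₗ (πC (n + 1) p ∘ₗ γ n ∘ₗ πC n p) ∘ₗ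
          (πC n p ∘ₗ dC n ∘ₗ πC (n + 1) p) := by
    rw [hperturb, LinearMap.sub_comp, LinearMap.comp_sub,
      (hdfC n).diag_comp (hgrC (n + 1)) (hγd n), (hγf n).diag_comp (hgrC n) (hdfC n)]
  refine forall_congr' fun n => forall_congr' fun p => ⟨fun h => ?_, fun h => ?_⟩
  · refine (sub_eq_zero.mp ?_).symm
    rw [← hdiag, (hφf n).diag_comp (hgrM n) (hdψ n),
      (hdfM n).diag_comp (hgrM (n + 1)) (hψf (n + 1)), h, LinearMap.zero_comp,
      LinearMap.comp_zero]
  · rw [hfactor,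
      (hψf n).diag_comp (hgrC n) ((hφdψ n).comp (hgrC (n + 1)) (hφf (n + 1))),
      (hφdψ n).diag_comp (hgrC (n + 1)) (hφf (n + 1)), hdiag, h, sub_self,
      LinearMap.zero_comp, LinearMap.comp_zero]
end

section
/- Let P be a finite poset, K a field, and let (C, π) be a P-graded chain complex such that each C_n is finite-dimensional over K and C_n = 0 for all but finitely many n ∈ ℤ. Then there exists a strict P-graded chain complex (C', π') together with P-filtered chain maps φ : (C', π') → (C, π) and ψ : (C, π) → (C', π') and P-filtered chain homotopies from ψ∘φ to id_{C'} and from φ∘ψ to id_C; that is, every such P-graded chain complex is P-filtered chain equivalent to a strict one (a Conley complex exists). -/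
/-- The `(p, q)`-components of `f` vanish unless `r p q` holds. -/
def HasSupport {K P V W : Type*} [Field K]
    [AddCommGroup V] [Module K V] [AddCommGroup W] [Module K W]
    (r : P → P → Prop) (πV : P → V →ₗ[K] V) (πW : P → W →ₗ[K] W) (f : V →ₗ[K] W) : Prop :=
  ∀ p q : P, πW p ∘ₗ f ∘ₗ πV q ≠ 0 → r p q

section Support

variable {K P V W X : Type*} [Field K]
  [AddCommGroup V] [Module K V] [AddCommGroup W] [Module K W] [AddCommGroup X] [Module K X]
  {r s t : P → P → Prop}
  {πV : P → V →ₗ[K] V} {πW : P → W →ₗ[K] W} {πX : P → X →ₗ[K] X}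

lemma HasSupport.zero : HasSupport r πV πW (0 : V →ₗ[K] W) := by
  intro p q h
  simp at h

lemma HasSupport.mono {f : V →ₗ[K] W} (hf : HasSupport r πV πW f) (h : ∀ p q, r p q → s p q) :
    HasSupport s πV πW f :=
  fun p q hpq => h p q (hf p q hpq)

lemma HasSupport.add {f g : V →ₗ[K] W} (hf : HasSupport r πV πW f) (hg : HasSupport r πV πW g) :
    HasSupport r πV πW (f + g) := by
  intro p q h
  by_contra hr
  have h₁ := not_imp_comm.1 (hf p q) hr
  have h₂ := not_imp_comm.1 (hg p q) hr
  simp [LinearMap.add_comp, LinearMap.comp_add, h₁, h₂] at h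

lemma HasSupport.neg {f : V →ₗ[K] W} (hf : HasSupport r πV πW f) :
    HasSupport r πV πW (-f) := by
  intro p q h
  refine hf p q fun h₀ => h ?_
  simp [LinearMap.neg_comp, LinearMap.comp_neg, h₀]

lemma HasSupport.sub {f g : V →ₗ[K] W} (hf : HasSupport r πV πW f) (hg : HasSupport r πV πW g) :
    HasSupport r πV πW (f - g) :=
  sub_eq_add_neg f g ▸ hf.add hg.neg

lemma HasSupport.sum {ι : Type*} {F : Finset ι} {f : ι → V →ₗ[K] W}
    (hf : ∀ i ∈ F, HasSupport r πV πW (f i)) : HasSupport r πV πW (∑ i ∈ F, f i) :=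
  Finset.sum_induction f _ (fun _ _ => HasSupport.add) HasSupport.zero hf

lemma HasSupport.of_and {f : V →ₗ[K] W} (hf : HasSupport r πV πW f)
    (hf' : HasSupport s πV πW f) :
    HasSupport (fun p q => r p q ∧ s p q) πV πW f :=
  fun p q h => ⟨hf p q h, hf' p q h⟩

variable [Fintype P]

lemma IsGrading.sum_apply (hV : IsGrading πV) (x : V) : ∑ p, πV p x = x := by
  simpa using LinearMap.congr_fun hV.2.1 x

lemma IsGrading.idem (hV : IsGrading πV) (p : P) (x : V) : πV p (πV p x) = πV p x :=
  LinearMap.congr_fun (hV.1 p) x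

lemma IsGrading.orthogonal (hV : IsGrading πV) {p q : P} (h : p ≠ q) (x : V) :
    πV p (πV q x) = 0 :=
  LinearMap.congr_fun (hV.2.2 p q h) x

lemma HasSupport.comp (hW : IsGrading πW) {g : W →ₗ[K] X} {f : V →ₗ[K] W}
    (hg : HasSupport r πW πX g) (hf : HasSupport s πV πW f)
    (h : ∀ p m q, r p m → s m q → t p q) : HasSupport t πV πX (g ∘ₗ f) := by
  intro p q hpq
  by_contra ht
  refine hpq (LinearMap.ext fun x => ?_)
  have key : ∀ m, πX p (g (πW m (f (πV q x)))) = 0 := by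
    intro m
    by_cases h₁ : πX p ∘ₗ g ∘ₗ πW m = 0
    · exact LinearMap.congr_fun h₁ _
    by_cases h₂ : πW m ∘ₗ f ∘ₗ πV q = 0
    · have := LinearMap.congr_fun h₂ x
      simp only [LinearMap.comp_apply, LinearMap.zero_apply] at this
      simp [this]
    exact absurd (h p m q (hg _ _ h₁) (hf _ _ h₂)) ht
  have : πX p (g (∑ m, πW m (f (πV q x)))) = 0 := by
    simp only [map_sum, key, Finset.sum_const_zero]
  simpa [hW.sum_apply] using this

lemma HasSupport.id (hV : IsGrading πV) : HasSupport Eq πV πV (LinearMap.id : V →ₗ[K] V) := by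
  intro p q h
  by_contra hpq
  exact h (by simpa using hV.2.2 p q hpq)

lemma HasSupport.eq_zero (hV : IsGrading πV) (hW : IsGrading πW) {f : V →ₗ[K] W}
    (hf : HasSupport r πV πW f) (h : ∀ p q, ¬ r p q) : f = 0 := by
  ext x
  have key : ∀ p q, πW p (f (πV q x)) = 0 := fun p q => by
    have := not_imp_comm.1 (hf p q) (h p q)
    exact LinearMap.congr_fun this x
  rw [← hW.sum_apply (f x), ← hV.sum_apply x]
  simp [map_sum, key]

lemma HasSupport.commute (hV : IsGrading πV) (hW : IsGrading πW) {f : V →ₗ[K] W}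
    (hf : HasSupport Eq πV πW f) (p : P) (x : V) : πW p (f x) = f (πV p x) := by
  have key : ∀ p q, p ≠ q → πW p (f (πV q x)) = 0 := fun p q h => by
    have := not_imp_comm.1 (hf p q) h
    exact LinearMap.congr_fun this x
  have h₁ : πW p (f x) = πW p (f (πV p x)) := by
    conv_lhs => rw [← hV.sum_apply x]
    simp only [map_sum]
    exact Finset.sum_eq_single p (fun q _ h => key p q h.symm) (by simp)
  have h₂ : f (πV p x) = πW p (f (πV p x)) := by
    conv_lhs => rw [← hW.sum_apply (f (πV p x))]
    exact Finset.sum_eq_single p (fun q _ h => key q p h) (by simp)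
  rw [h₁, ← h₂]

/-- The diagonal part of a linear map between graded vector spaces. -/
def diagonalPart (πV : P → V →ₗ[K] V) (πW : P → W →ₗ[K] W) (f : V →ₗ[K] W) : V →ₗ[K] W :=
  ∑ p, πW p ∘ₗ f ∘ₗ πV p

lemma diagonalPart_apply (f : V →ₗ[K] W) (x : V) :
    diagonalPart πV πW f x = ∑ p, πW p (f (πV p x)) := by
  simp [diagonalPart]

lemma diagonalPart_component (hV : IsGrading πV) (hW : IsGrading πW) (f : V →ₗ[K] W)
    (p : P) (x : V) : πW p (diagonalPart πV πW f (πV p x)) = πW p (f (πV p x)) := by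
  rw [diagonalPart_apply, map_sum, Finset.sum_eq_single p]
  · rw [hW.idem, hV.idem]
  · intro q _ h
    exact hW.orthogonal h.symm _
  · simp

lemma diagonalPart_hasSupport (hV : IsGrading πV) (hW : IsGrading πW) (f : V →ₗ[K] W) :
    HasSupport Eq πV πW (diagonalPart πV πW f) := by
  intro p q h
  by_contra hpq
  refine h (LinearMap.ext fun x => ?_)
  simp only [LinearMap.comp_apply, diagonalPart_apply, map_sum, LinearMap.zero_apply]
  refine Finset.sum_eq_zero fun m _ => ?_
  by_cases hm : p = m
  · subst hm
    simp [hV.orthogonal hpq]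
  · exact hW.orthogonal hm _

/-- A diagonal map has a diagonal generalized inverse. -/
lemma exists_diagonal_generalizedInverse (hV : IsGrading πV) (hW : IsGrading πW) {f : V →ₗ[K] W}
    (hf : HasSupport Eq πV πW f) :
    ∃ g : W →ₗ[K] V, HasSupport Eq πW πV g ∧ ∀ x, f (g (f x)) = f x := by
  obtain ⟨s, hs⟩ := f.rangeRestrict.exists_rightInverse_of_surjective f.range_rangeRestrict
  obtain ⟨g, hg⟩ := LinearMap.exists_extend s
  have hfg : ∀ x, f (g (f x)) = f x := fun x => by
    have h₁ : g (f x) = s (f.rangeRestrict x) := LinearMap.congr_fun hg (f.rangeRestrict x)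
    have h₂ := LinearMap.congr_fun hs (f.rangeRestrict x)
    rw [h₁]
    exact congrArg Subtype.val h₂
  refine ⟨diagonalPart πW πV g, diagonalPart_hasSupport hW hV g, fun x => ?_⟩
  rw [diagonalPart_apply, map_sum]
  calc ∑ p, f (πV p (g (πW p (f x)))) = ∑ p, πW p (f x) := by
        refine Finset.sum_congr rfl fun p _ => ?_
        rw [← hf.commute hV hW, hf.commute hV hW p x, hfg, ← hf.commute hV hW, hW.idem]
    _ = f x := hW.sum_apply _

variable [PartialOrder P]

lemma HasSupport.strict_sub_diagonalPart (hV : IsGrading πV) (hW : IsGrading πW) {f : V →ₗ[K] W}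
    (hf : HasSupport (· ≤ ·) πV πW f) :
    HasSupport (· < ·) πV πW (f - diagonalPart πV πW f) := by
  intro p q h
  have hle := (hf.sub ((diagonalPart_hasSupport hV hW f).mono fun _ _ => le_of_eq)) p q h
  refine lt_of_le_of_ne hle fun hpq => h ?_
  subst hpq
  ext x
  simp [diagonalPart_component hV hW]

lemma HasSupport.isNilpotent (hV : IsGrading πV) {f : Module.End K V}
    (hf : HasSupport (· < ·) πV πV f) : IsNilpotent f := by
  have key : ∀ q, ∃ k : ℕ, ∀ x, (f ^ k) (πV q x) = 0 := by
    intro q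
    induction q using WellFoundedLT.induction with
    | ind q ih =>
      choose! k hk using ih
      refine ⟨(∑ p, k p) + 1, fun x => ?_⟩
      rw [pow_succ, Module.End.mul_apply, ← hV.sum_apply (f (πV q x)), map_sum]
      refine Finset.sum_eq_zero fun p _ => ?_
      by_cases hpq : p < q
      · have hle : k p ≤ ∑ p, k p := Finset.single_le_sum (fun _ _ => Nat.zero_le _) (Finset.mem_univ p)
        obtain ⟨l, hl⟩ := Nat.exists_eq_add_of_le' hle
        rw [hl, pow_add, Module.End.mul_apply, hk p hpq, map_zero]
      · have := not_imp_comm.1 (hf p q) hpq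
        have := LinearMap.congr_fun this x
        simp only [LinearMap.comp_apply, LinearMap.zero_apply] at this
        rw [this, map_zero]
  choose k hk using key
  refine ⟨∑ p, k p, LinearMap.ext fun x => ?_⟩
  rw [← hV.sum_apply x, map_sum]
  refine Finset.sum_eq_zero fun p _ => ?_
  have hle : k p ≤ ∑ p, k p := Finset.single_le_sum (fun _ _ => Nat.zero_le _) (Finset.mem_univ p)
  obtain ⟨l, hl⟩ := Nat.exists_eq_add_of_le' hle
  rw [hl, pow_add, Module.End.mul_apply, hk p, map_zero]

/-- A strictly filtered perturbation of the identity has a filtered inverse. -/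
lemma HasSupport.exists_inverse_one_add (hV : IsGrading πV) {f : V →ₗ[K] V}
    (hf : HasSupport (· < ·) πV πV f) :
    ∃ g : V →ₗ[K] V, HasSupport (· ≤ ·) πV πV g ∧
      (∀ x, g x + f (g x) = x) ∧ ∀ x, g x + g (f x) = x := by
  let F : Module.End K V := f
  obtain ⟨k, hk⟩ : IsNilpotent F := hf.isNilpotent hV
  have hpow : ∀ i, HasSupport (· ≤ ·) πV πV ((-F) ^ i) := by
    intro i
    induction i with
    | zero => exact (HasSupport.id hV).mono fun _ _ => le_of_eq
    | succ i ih =>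
      rw [pow_succ]
      exact ih.comp hV hf.neg fun _ _ _ h₁ h₂ => h₁.trans h₂.le
  have hk' : (-F) ^ k = 0 := by rw [neg_pow, hk, mul_zero]
  refine ⟨∑ i ∈ Finset.range k, (-F) ^ i, HasSupport.sum fun i _ => hpow i, fun x => ?_, fun x => ?_⟩
  · have := LinearMap.congr_fun (mul_neg_geom_sum (-F) k) x
    rw [hk', sub_zero, sub_neg_eq_add, add_mul, one_mul] at this
    exact this
  · have := LinearMap.congr_fun (geom_sum_mul_neg (-F) k) x
    rw [hk', sub_zero, sub_neg_eq_add, mul_add, mul_one] at this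
    exact this

end Support

lemma Int.forall_of_forall_add_one {Q : ℤ → Prop} (h : ∀ n, Q (n + 1)) (n : ℤ) : Q n := by
  simpa using h (n - 1)

lemma Int.exists_section_of_add_one {T : ℤ → Type*} (f : ∀ n, T (n + 1)) :
    ∃ g : ∀ n, T n, ∀ n, g (n + 1) = f n := by
  have key : ∀ n, ∃ y : T n, ∀ m (h : m + 1 = n), y = h ▸ f m :=
    Int.forall_of_forall_add_one fun n => ⟨f n, fun m h => by
      obtain rfl : m = n := by omega
      rfl⟩
  choose g hg using key
  exact ⟨g, fun n => hg (n + 1) n rfl⟩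

section Complex

variable {K P : Type*} [Field K] [Fintype P] {C : ℤ → Type*}
  [∀ n, AddCommGroup (C n)] [∀ n, Module K (C n)] {π : ∀ n : ℤ, P → C n →ₗ[K] C n}

/-- A complex with diagonal differential admits a diagonal contraction onto its homology
satisfying the side conditions `h d h = h` and `h h = 0`. -/
lemma exists_diagonal_contraction (hgr : ∀ n, IsGrading (π n)) (d : ∀ n : ℤ, C (n + 1) →ₗ[K] C n)
    (hd : ∀ n, HasSupport Eq (π (n + 1)) (π n) (d n))
    (hdd : ∀ (n : ℤ) (x : C (n + 1 + 1)), d n (d (n + 1) x) = 0) :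
    ∃ h : ∀ n : ℤ, C n →ₗ[K] C (n + 1),
      (∀ n, HasSupport Eq (π n) (π (n + 1)) (h n)) ∧
      (∀ n x, d n (h n (d n x)) = d n x) ∧
      (∀ n x, h n (d n (h n x)) = h n x) ∧
      (∀ n x, h (n + 1) (h n x) = 0) := by
  choose a had ha using fun n =>
    exists_diagonal_generalizedInverse (hgr (n + 1)) (hgr n) (hd n)
  have htrans : ∀ p m q : P, p = m → m = q → p = q := fun _ _ _ => Eq.trans
  let g : ∀ n, C n →ₗ[K] C (n + 1) := fun n => a n ∘ₗ d n ∘ₗ a n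
  have hg : ∀ n, HasSupport Eq (π n) (π (n + 1)) (g n) := fun n =>
    (had n).comp (hgr n) ((hd n).comp (hgr (n + 1)) (had n) htrans) htrans
  have hdgd : ∀ n x, d n (g n (d n x)) = d n x := fun n x => by simp [g, ha]
  have hgdg : ∀ n x, g n (d n (g n x)) = g n x := fun n x => by simp [g, ha]
  obtain ⟨b, hb⟩ := Int.exists_section_of_add_one (T := fun n => C n →ₗ[K] C (n + 1))
    fun n => g (n + 1) ∘ₗ g n ∘ₗ d n
  refine ⟨fun n => g n - b n, fun n => (hg n).sub ?_, ?_, ?_, ?_⟩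
  · revert n
    refine Int.forall_of_forall_add_one fun n => ?_
    rw [hb]
    exact (hg (n + 1)).comp (hgr (n + 1)) ((hg n).comp (hgr n) (hd n) htrans) htrans
  all_goals refine Int.forall_of_forall_add_one fun n x => ?_
  all_goals simp [hb, hdd, hdgd, hgdg]

end Complex

universe u v

/-- Every P-graded chain complex of finite-dimensional vector
spaces that vanishes outside finitely many degrees is P-filtered chain
homotopy equivalent to a strict P-graded chain complex: a Conley complex
exists. -/
theorem stmt_17 {K : Type u} [Field K] {P : Type*} [PartialOrder P] [Fintype P]
    {C : ℤ → Type v}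
    [∀ n, AddCommGroup (C n)] [∀ n, Module K (C n)]
    [∀ n, FiniteDimensional K (C n)]
    (hbdd : ∃ s : Finset ℤ, ∀ n ∉ s, ∀ x : C n, x = 0)
    (π : ∀ n : ℤ, P → C n →ₗ[K] C n)
    (hgr : ∀ n, IsGrading (π n))
    (d : ∀ n : ℤ, C (n + 1) →ₗ[K] C n)
    (hdf : ∀ n, IsFilteredMap (π (n + 1)) (π n) (d n))
    (hdd : ∀ (n : ℤ) (x : C (n + 1 + 1)), d n (d (n + 1) x) = 0) :
    ∃ (C' : ℤ → ModuleCat.{v} K)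
      (π' : ∀ n : ℤ, P → (↥(C' n) →ₗ[K] ↥(C' n)))
      (d' : ∀ n : ℤ, ↥(C' (n + 1)) →ₗ[K] ↥(C' n)),
      -- (C', π') is a P-graded chain complex
      (∀ n, IsGrading (π' n)) ∧
      (∀ n, IsFilteredMap (π' (n + 1)) (π' n) (d' n)) ∧
      (∀ (n : ℤ) (x : ↥(C' (n + 1 + 1))), d' n (d' (n + 1) x) = 0) ∧
      -- (C', π') is strict
      (∀ (n : ℤ) (p : P), π' n p ∘ₗ d' n ∘ₗ π' (n + 1) p = 0) ∧
      -- (C', π') is P-filtered chain homotopy equivalent to (C, π)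
      ∃ (φ : ∀ n : ℤ, ↥(C' n) →ₗ[K] C n) (ψ : ∀ n : ℤ, C n →ₗ[K] ↥(C' n))
        (γ : ∀ n : ℤ, C n →ₗ[K] C (n + 1))
        (γ' : ∀ n : ℤ, ↥(C' n) →ₗ[K] ↥(C' (n + 1))),
        (∀ n, IsFilteredMap (π' n) (π n) (φ n)) ∧
        (∀ n, IsFilteredMap (π n) (π' n) (ψ n)) ∧
        (∀ (n : ℤ) (x : ↥(C' (n + 1))), φ n (d' n x) = d n (φ (n + 1) x)) ∧
        (∀ (n : ℤ) (x : C (n + 1)), ψ n (d n x) = d' n (ψ (n + 1) x)) ∧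
        (∀ n, IsFilteredMap (π' n) (π' (n + 1)) (γ' n)) ∧
        (∀ n, IsFilteredMap (π n) (π (n + 1)) (γ n)) ∧
        -- γ' is a P-filtered chain homotopy from ψ∘φ to the identity of C'
        (∀ (n : ℤ) (x : ↥(C' (n + 1))),
          ψ (n + 1) (φ (n + 1) x) - x = γ' n (d' n x) + d' (n + 1) (γ' (n + 1) x)) ∧
        -- γ is a P-filtered chain homotopy from φ∘ψ to the identity of C
        (∀ (n : ℤ) (x : C (n + 1)),
          φ (n + 1) (ψ (n + 1) x) - x = γ n (d n x) + d (n + 1) (γ (n + 1) x)) := by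
  have hle_le : ∀ p m q : P, p ≤ m → m ≤ q → p ≤ q := fun _ _ _ => le_trans
  have heq_le : ∀ p m q : P, p = m → m ≤ q → p ≤ q := fun _ _ _ h₁ h₂ => h₁.le.trans h₂
  have hle_eq : ∀ p m q : P, p ≤ m → m = q → p ≤ q := fun _ _ _ h₁ h₂ => h₁.trans h₂.le
  have heq_lt : ∀ p m q : P, p = m → m < q → p < q := fun _ _ _ h₁ h₂ => h₁.trans_lt h₂
  have hlt_eq : ∀ p m q : P, p < m → m = q → p < q := fun _ _ _ h₁ h₂ => h₁.trans_eq h₂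
  have hlt_le : ∀ p m q : P, p < m → m ≤ q → p < q := fun _ _ _ => lt_of_lt_of_le
  have hlt_lt : ∀ p m q : P, p < m → m < q → p < q := fun _ _ _ => lt_trans
  have heq_eq : ∀ p m q : P, p = m → m = q → p = q := fun _ _ _ => Eq.trans
  have hdf' : ∀ n, HasSupport (· ≤ ·) (π (n + 1)) (π n) (d n) := hdf
  -- Split the differential into its diagonal part and a strictly filtered perturbation.
  let d₀ : ∀ n, C (n + 1) →ₗ[K] C n := fun n => diagonalPart (π (n + 1)) (π n) (d n)
  let N : ∀ n, C (n + 1) →ₗ[K] C n := fun n => d n - d₀ n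
  have hd : ∀ n x, d n x = d₀ n x + N n x := fun n x => by simp [N]
  have hd₀ : ∀ n, HasSupport Eq (π (n + 1)) (π n) (d₀ n) := fun n =>
    diagonalPart_hasSupport (hgr (n + 1)) (hgr n) (d n)
  have hN : ∀ n, HasSupport (· < ·) (π (n + 1)) (π n) (N n) := fun n =>
    (hdf' n).strict_sub_diagonalPart (hgr (n + 1)) (hgr n)
  have hdd_expand : ∀ n x, d₀ n (d₀ (n + 1) x) + (d₀ n (N (n + 1) x) + N n (d₀ (n + 1) x)
      + N n (N (n + 1) x)) = 0 := fun n x => by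
    have := hdd n x
    simp only [hd, map_add] at this
    rw [← this]
    abel
  have hd₀d₀ : ∀ n x, d₀ n (d₀ (n + 1) x) = 0 := fun n => by
    have hdiag := (hd₀ n).comp (hgr (n + 1)) (hd₀ (n + 1)) heq_eq
    have hstrict : HasSupport (· < ·) (π (n + 1 + 1)) (π n) (d₀ n ∘ₗ d₀ (n + 1)) := by
      have : d₀ n ∘ₗ d₀ (n + 1) =
          -(d₀ n ∘ₗ N (n + 1) + N n ∘ₗ d₀ (n + 1) + N n ∘ₗ N (n + 1)) :=
        LinearMap.ext fun x => eq_neg_of_add_eq_zero_left (hdd_expand n x)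
      rw [this]
      exact ((((hd₀ n).comp (hgr (n + 1)) (hN (n + 1)) heq_lt).add
        ((hN n).comp (hgr (n + 1)) (hd₀ (n + 1)) hlt_eq)).add
        ((hN n).comp (hgr (n + 1)) (hN (n + 1)) hlt_lt)).neg
    have := (hdiag.of_and hstrict).eq_zero (hgr _) (hgr _) fun p q h => h.2.ne h.1
    exact fun x => LinearMap.congr_fun this x
  have hMC : ∀ n x, N n (d₀ (n + 1) x) = -d₀ n (N (n + 1) x) - N n (N (n + 1) x) := fun n x => by
    have := hdd_expand n x
    rw [hd₀d₀, zero_add] at this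
    rw [← sub_eq_zero, ← this]
    abel
  obtain ⟨h, hh, hdhd, hhdh, hhh⟩ := exists_diagonal_contraction hgr d₀ hd₀ hd₀d₀
  obtain ⟨k, hk⟩ := Int.exists_section_of_add_one (T := fun n => C n →ₗ[K] C n)
    fun n => h n ∘ₗ d₀ n
  obtain ⟨j, hj⟩ := Int.exists_section_of_add_one (T := fun n => C n →ₗ[K] C n)
    fun n => h n ∘ₗ N n
  have hks : ∀ n, HasSupport Eq (π n) (π n) (k n) := Int.forall_of_forall_add_one fun n => by
    rw [hk]
    exact (hh n).comp (hgr n) (hd₀ n) heq_eq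
  have hjs : ∀ n, HasSupport (· < ·) (π n) (π n) (j n) := Int.forall_of_forall_add_one fun n => by
    rw [hj]
    exact (hh n).comp (hgr n) (hN n) heq_lt
  -- The projection onto the homology of the diagonal part.
  let e : ∀ n, C n →ₗ[K] C n := fun n => LinearMap.id - d₀ n ∘ₗ h n - k n
  have he : ∀ n, HasSupport Eq (π n) (π n) (e n) := fun n =>
    ((HasSupport.id (hgr n)).sub ((hd₀ n).comp (hgr (n + 1)) (hh n) heq_eq)).sub (hks n)
  have hee : ∀ n x, e n (e n x) = e n x := Int.forall_of_forall_add_one fun n x => by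
    simp [e, hk, hd₀d₀, hdhd, hhdh, hhh]
  have hed₀ : ∀ n x, e n (d₀ n x) = 0 := Int.forall_of_forall_add_one fun n x => by
    simp [e, hk, hd₀d₀, hdhd]
  have heh : ∀ n x, e (n + 1) (h n x) = 0 := fun n x => by
    simp [e, hk, hhdh, hhh]
  have hhe : ∀ n x, h n (e n x) = 0 := Int.forall_of_forall_add_one fun n x => by
    simp [e, hk, hhdh, hhh]
  -- Inverses of `1 + h N` and `1 + N h`.
  choose A hA hA_right hA_left using fun n => (hjs n).exists_inverse_one_add (hgr n)
  have hNh : ∀ n, HasSupport (· < ·) (π n) (π n) (N n ∘ₗ h n) := fun n =>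
    (hN n).comp (hgr (n + 1)) (hh n) hlt_eq
  choose B hB hB_right hB_left using fun n => (hNh n).exists_inverse_one_add (hgr n)
  simp only [LinearMap.comp_apply] at hB_right hB_left
  have hAh : ∀ n x, A (n + 1) (h n x) = h n (B n x) := fun n x => by
    have h₁ := hA_left (n + 1) (h n (B n x))
    rw [hj, LinearMap.comp_apply, ← map_add, ← map_add, hB_right] at h₁
    exact h₁
  have hBh : ∀ n x, B (n + 1) (h n x) = h n x := fun n x => by
    have := hB_left (n + 1) (h n x)
    simpa [hhh] using this
  have hBe : ∀ n x, B n (e n x) = e n x := fun n x => by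
    have := hB_left n (e n x)
    simpa [hhe] using this
  have heBA : ∀ n x, e n (B n (A n (e n x))) = e n x := Int.forall_of_forall_add_one fun n x => by
    have h₁ := congrArg (fun y => e (n + 1) (B (n + 1) y)) (hA_right (n + 1) (e (n + 1) x))
    simpa [hj, hBh, heh, hBe, hee] using h₁
  have hAeB : ∀ n x, A (n + 1) (e (n + 1) (B (n + 1) x)) =
      x - h n (B n (d n x)) - d (n + 1) (h (n + 1) (B (n + 1) x)) := fun n x => by
    have hx := hB_right (n + 1) x
    set y := B (n + 1) x
    rw [← hAh]
    have h₁ := hA_left (n + 1) (x - d (n + 1) (h (n + 1) y))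
    rw [← map_add] at h₁
    have h₂ : e (n + 1) y + h n (d n x) = x - d (n + 1) (h (n + 1) y)
        + j (n + 1) (x - d (n + 1) (h (n + 1) y)) := by
      rw [← hx]
      simp only [e, hk, hj, hd, hMC, LinearMap.comp_apply, LinearMap.sub_apply,
        LinearMap.id_apply, map_add, map_sub, map_neg]
      abel
    rw [← h₂, map_add] at h₁
    rw [eq_sub_of_add_eq h₁]
    abel
  -- The Conley complex lives on the ranges of the projections `e n`.
  let ι : ∀ n, LinearMap.range (e n) →ₗ[K] C n := fun n => (LinearMap.range (e n)).subtype
  let ρ : ∀ n, C n →ₗ[K] LinearMap.range (e n) := fun n => (e n).rangeRestrict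
  have hιρ : ∀ n x, ι n (ρ n x) = e n x := fun n x => rfl
  have hι_inj : ∀ n, Function.Injective (ι n) := fun n => Subtype.val_injective
  have heι : ∀ n x, e n (ι n x) = ι n x := by
    rintro n ⟨_, y, rfl⟩
    exact hee n y
  let π' : ∀ n, P → LinearMap.range (e n) →ₗ[K] LinearMap.range (e n) :=
    fun n p => ρ n ∘ₗ π n p ∘ₗ ι n
  have hιπ' : ∀ n p x, ι n (π' n p x) = π n p (ι n x) := fun n p x => by
    change e n (π n p (ι n x)) = _
    rw [← (he n).commute (hgr n) (hgr n), heι]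
  have hπ'ρ : ∀ n p x, π' n p (ρ n x) = ρ n (π n p x) := fun n p x => by
    apply hι_inj n
    rw [hιπ', hιρ, hιρ, (he n).commute (hgr n) (hgr n)]
  have hgr' : ∀ n, IsGrading (π' n) := fun n => by
    refine ⟨fun p => ?_, ?_, fun p q hpq => ?_⟩
    · ext1 x
      apply hι_inj n
      simp only [LinearMap.comp_apply, hιπ', (hgr n).idem]
    · ext1 x
      apply hι_inj n
      simp only [LinearMap.sum_apply, map_sum, hιπ', (hgr n).sum_apply, LinearMap.id_apply]
    · ext1 x
      apply hι_inj n
      simp only [LinearMap.comp_apply, hιπ', (hgr n).orthogonal hpq, LinearMap.zero_apply,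
        map_zero]
  have hι : ∀ n, HasSupport Eq (π' n) (π n) (ι n) := fun n p q hpq => by
    by_contra hne
    refine hpq (LinearMap.ext fun x => ?_)
    simp only [LinearMap.comp_apply, hιπ', (hgr n).orthogonal hne, LinearMap.zero_apply]
  have hρ : ∀ n, HasSupport Eq (π n) (π' n) (ρ n) := fun n p q hpq => by
    by_contra hne
    refine hpq (LinearMap.ext fun x => ?_)
    simp only [LinearMap.comp_apply, hπ'ρ, (hgr n).orthogonal hne, LinearMap.zero_apply, map_zero]
  let φ : ∀ n, LinearMap.range (e n) →ₗ[K] C n := fun n => A n ∘ₗ ι n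
  let ψ : ∀ n, C n →ₗ[K] LinearMap.range (e n) := fun n => ρ n ∘ₗ B n
  have hφ : ∀ n, HasSupport (· ≤ ·) (π' n) (π n) (φ n) := fun n =>
    (hA n).comp (hgr n) (hι n) hle_eq
  have hψ : ∀ n, HasSupport (· ≤ ·) (π n) (π' n) (ψ n) := fun n =>
    (hρ n).comp (hgr n) (hB n) heq_le
  have hψφ : ∀ n x, ψ n (φ n x) = x := fun n x => by
    apply hι_inj n
    have := heBA n (ι n x)
    rw [heι] at this
    exact this
  have hφψ : ∀ n x, φ (n + 1) (ψ (n + 1) x) =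
      x - h n (B n (d n x)) - d (n + 1) (h (n + 1) (B (n + 1) x)) := hAeB
  have hcomm : ∀ n x, φ n (ψ n (d n x)) = d n (φ (n + 1) (ψ (n + 1) x)) :=
    Int.forall_of_forall_add_one fun n x => by
      simp [hφψ, hdd]
  -- `ψ d` is strictly filtered because `e` annihilates the range of the diagonal part.
  have hψd : ∀ n, HasSupport (· < ·) (π (n + 1)) (π' n) (ψ n ∘ₗ d n) := fun n => by
    have : ψ n ∘ₗ d n = ρ n ∘ₗ N n - ρ n ∘ₗ (N n ∘ₗ h n) ∘ₗ B n ∘ₗ d n := by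
      ext1 x
      apply hι_inj n
      simp only [ψ, LinearMap.comp_apply, LinearMap.sub_apply, map_sub, hιρ]
      have h₁ := congrArg (e n) (hB_right n (d n x))
      rw [map_add] at h₁
      rw [eq_sub_of_add_eq h₁]
      congr 1
      rw [hd, map_add, hed₀, zero_add]
    rw [this]
    exact ((hρ n).comp (hgr n) (hN n) heq_lt).sub
      ((hρ n).comp (hgr n) ((hNh n).comp (hgr n) ((hB n).comp (hgr n) (hdf' n) hle_le) hlt_le)
        heq_lt)
  have hd' : ∀ n, HasSupport (· < ·) (π' (n + 1)) (π' n) (ψ n ∘ₗ d n ∘ₗ φ (n + 1)) := fun n =>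
    (hψd n).comp (hgr (n + 1)) (hφ (n + 1)) hlt_le
  refine ⟨fun n => ModuleCat.of K (LinearMap.range (e n)), π', fun n => ψ n ∘ₗ d n ∘ₗ φ (n + 1),
    hgr', fun n => (hd' n).mono fun _ _ => le_of_lt, fun n x => ?_, fun n p => ?_,
    φ, ψ, fun n => -(h n ∘ₗ B n), fun n => 0, hφ, hψ, fun n x => ?_, fun n x => ?_,
    fun n => HasSupport.zero, fun n => ?_, fun n x => ?_, fun n x => ?_⟩
  · change ψ n (d n (φ (n + 1) (ψ (n + 1) (d (n + 1) (φ (n + 1 + 1) x))))) = 0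
    rw [hcomm, hdd, map_zero]
  · by_contra hne
    exact lt_irrefl p (hd' n p p hne)
  · change φ n (ψ n (d n (φ (n + 1) x))) = _
    rw [hcomm, hψφ]
  · change _ = ψ n (d n (φ (n + 1) (ψ (n + 1) x)))
    rw [← hcomm, hψφ]
  · exact ((hh n).comp (hgr n) (hB n) heq_le).neg
  · change ψ (n + 1) (φ (n + 1) x) - x = 0 + (ψ (n + 1) ∘ₗ d (n + 1) ∘ₗ φ (n + 1 + 1)) 0
    rw [hψφ, sub_self, map_zero, add_zero]
  · rw [hφψ]
    simp only [LinearMap.neg_apply, LinearMap.comp_apply, map_neg]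
    abel
end
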